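/- (Linear-in-time bounds on the numerical solution) Assume (A0) and (A1), and suppose the CFL condition (CFL′) is satisfied. If (U^{α,n}_i) is the numerical solution of the scheme (NS) with initial condition U^{α,0}_i = u₀^α(iΔx), then for every α = 1,…,N, every i ≥ 0 and every n ≥ 0: m⁰₀ · nΔt ≤ U^{α,n}_i − U^{α,0}_i ≤ M⁰₀ · nΔt. -/

import Mathlib

open Set Filter

/-- Assumption (A1) for a single Hamiltonian: `H` is `C¹`, coercive
(`H p → +∞` as `|p| → +∞`), non-increasing on `(-∞, p₀]` and non-decreasing on `[p₀, +∞)`. -/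
def A1cond (H : ℝ → ℝ) (p₀ : ℝ) : Prop :=
  ContDiff ℝ 1 H ∧ Tendsto H (cocompact ℝ) atTop ∧
    AntitoneOn H (Iic p₀) ∧ MonotoneOn H (Ici p₀)

/-- The non-increasing envelope `H⁻` of `H` with turning point `p₀`. -/
noncomputable def Hm (H : ℝ → ℝ) (p₀ : ℝ) (p : ℝ) : ℝ :=
  if p ≤ p₀ then H p else H p₀

/-- The non-decreasing envelope `H⁺` of `H` with turning point `p₀`. -/
noncomputable def Hp (H : ℝ → ℝ) (p₀ : ℝ) (p : ℝ) : ℝ :=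
  if p ≤ p₀ then H p₀ else H p

/-- One time step of the numerical scheme (NS) on the junction:
`V` (the values at time `n+1`) is computed from `U` (the values at time `n`).
For `i ≥ 1` on each branch `α` the update uses
`max (H⁺_α(p_{i,-}), H⁻_α(p_{i,+}))`; at the junction point `i = 0` all branches share a
common value and the update uses `max_β H⁻_β(p^β_{0,+})`. -/
def SchemeStep {N : ℕ} (H : Fin N → ℝ → ℝ) (p₀ : Fin N → ℝ) (Δx Δt : ℝ)
    (U V : Fin N → ℕ → ℝ) : Prop :=
  (∀ (α : Fin N) (i : ℕ), 1 ≤ i →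
      V α i = U α i - Δt * max (Hp (H α) (p₀ α) ((U α i - U α (i - 1)) / Δx))
        (Hm (H α) (p₀ α) ((U α (i + 1) - U α i) / Δx))) ∧
  (∀ α β : Fin N, U α 0 = U β 0) ∧
  (∀ α : Fin N, V α 0 = U α 0 - Δt *
      sSup (Set.range fun β : Fin N => Hm (H β) (p₀ β) ((U β 1 - U β 0) / Δx)))

/-- The numerical scheme (NS): `U α n i` is the value on branch `α` at time step `n`
and grid point `i`. -/
def SchemeNS {N : ℕ} (H : Fin N → ℝ → ℝ) (p₀ : Fin N → ℝ) (Δx Δt : ℝ)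
    (U : Fin N → ℕ → ℕ → ℝ) : Prop :=
  ∀ n : ℕ, SchemeStep H p₀ Δx Δt (fun α i => U α n i) (fun α i => U α (n + 1) i)

theorem Hm_eq (H : ℝ → ℝ) (p₀ p : ℝ) : Hm H p₀ p = H (min p p₀) := by
  unfold Hm
  split_ifs with h
  · rw [min_eq_left h]
  · rw [min_eq_right (le_of_not_ge h)]

theorem Hp_eq (H : ℝ → ℝ) (p₀ p : ℝ) : Hp H p₀ p = H (max p p₀) := by
  unfold Hp
  split_ifs with h
  · rw [max_eq_right h]
  · rw [max_eq_left (le_of_not_ge h)]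

theorem Hp_neg (H : ℝ → ℝ) (p₀ q : ℝ) :
    Hp H p₀ (-q) = Hm (fun p => H (-p)) (-p₀) q := by
  rw [Hp_eq, Hm_eq, ← max_neg_neg, neg_neg]

namespace A1cond

variable {H : ℝ → ℝ} {p₀ : ℝ}

theorem comp_neg (h : A1cond H p₀) : A1cond (fun p => H (-p)) (-p₀) := by
  obtain ⟨h1, h2, h3, h4⟩ := h
  refine ⟨h1.comp contDiff_neg, h2.comp (Homeomorph.neg ℝ).isClosedEmbedding.tendsto_cocompact,
    fun a ha b hb hab => ?_, fun a ha b hb hab => ?_⟩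
  · simp only [mem_Iic] at ha hb
    exact h4 (mem_Ici.2 (by linarith)) (mem_Ici.2 (by linarith)) (neg_le_neg hab)
  · simp only [mem_Ici] at ha hb
    exact h3 (mem_Iic.2 (by linarith)) (mem_Iic.2 (by linarith)) (neg_le_neg hab)

theorem apply_le (h : A1cond H p₀) (p : ℝ) : H p₀ ≤ H p := by
  rcases le_total p p₀ with hp | hp
  · exact h.2.2.1 hp self_mem_Iic hp
  · exact h.2.2.2 self_mem_Ici hp hp

theorem antitone_Hm (h : A1cond H p₀) : Antitone (Hm H p₀) := fun a b hab => by
  rw [Hm_eq, Hm_eq]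
  exact h.2.2.1 (mem_Iic.2 (min_le_right _ _)) (mem_Iic.2 (min_le_right _ _))
    (min_le_min_right _ hab)

theorem monotone_Hp (h : A1cond H p₀) : Monotone (Hp H p₀) := fun a b hab => by
  rw [Hp_eq, Hp_eq]
  exact h.2.2.2 (mem_Ici.2 (le_max_right _ _)) (mem_Ici.2 (le_max_right _ _))
    (max_le_max_right _ hab)

theorem Hm_le (h : A1cond H p₀) (p : ℝ) : Hm H p₀ p ≤ H p := by
  unfold Hm
  split_ifs
  exacts [le_rfl, h.apply_le p]

theorem Hp_le (h : A1cond H p₀) (p : ℝ) : Hp H p₀ p ≤ H p := by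
  unfold Hp
  split_ifs
  exacts [h.apply_le p, le_rfl]

theorem le_Hm (h : A1cond H p₀) (p : ℝ) : H p₀ ≤ Hm H p₀ p := by
  rw [Hm_eq]
  exact h.apply_le _

/-- The infimum of a level set of `H⁻` is attained, and `H⁻` lies above the level to its left. -/
theorem sInf_level (h : A1cond H p₀) {μ : ℝ} (hμ : H p₀ ≤ μ) :
    sInf {p | Hm H p₀ p = μ} ≤ p₀ ∧ Hm H p₀ (sInf {p | Hm H p₀ p = μ}) = μ ∧
      ∀ q < sInf {p | Hm H p₀ p = μ}, μ < Hm H p₀ q := by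
  have hHc : Continuous H := h.1.continuous
  have hcont : Continuous (Hm H p₀) := by
    rw [funext (Hm_eq H p₀)]
    fun_prop
  have hbot : Tendsto H atBot atTop := h.2.1.mono_left atBot_le_cocompact
  obtain ⟨B, hB⟩ := eventually_atBot.1 (hbot.eventually_gt_atTop μ)
  have hm : min B p₀ ≤ p₀ := min_le_right _ _
  obtain ⟨r, hr, hrμ⟩ : μ ∈ H '' Icc (min B p₀) p₀ :=
    intermediate_value_Icc' hm hHc.continuousOn ⟨hμ, (hB _ (min_le_left _ _)).le⟩
  set S : Set ℝ := {p | Hm H p₀ p = μ}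
  have hrS : r ∈ S := by
    change Hm H p₀ r = μ
    rw [Hm_eq, min_eq_left hr.2, hrμ]
  have hbdd : BddBelow S := ⟨min B p₀, fun p hp => by
    by_contra! hlt
    have hp' : Hm H p₀ p = μ := hp
    rw [Hm_eq, min_eq_left (hlt.le.trans hm)] at hp'
    exact (hB p (hlt.le.trans (min_le_left _ _))).ne' hp'⟩
  have hmem : Hm H p₀ (sInf S) = μ :=
    (isClosed_eq hcont continuous_const).csInf_mem ⟨r, hrS⟩ hbdd
  refine ⟨(csInf_le hbdd hrS).trans hr.2, hmem, fun q hq => ?_⟩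
  refine lt_of_le_of_ne (hmem ▸ h.antitone_Hm hq.le) fun he => ?_
  exact hq.not_ge (csInf_le hbdd he.symm)

end A1cond

/-- One-sided Lipschitz control of `f` near the sublevel set `{f ≤ μ}`. -/
def LipschitzBelow (f : ℝ → ℝ) (c μ : ℝ) : Prop :=
  (∀ d d' t, 0 ≤ t → f d + c * t ≤ μ → d - t ≤ d' → f d' ≤ μ) ∧
    ∀ d d' t, 0 ≤ t → f d ≤ μ → d' ≤ d + t → f d ≤ f d' + c * t

theorem Antitone.lipschitzBelow {f : ℝ → ℝ} (hf : Antitone f) {L c μ : ℝ} (hc : 0 < c)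
    (hL : f L = μ) (hlt : ∀ q < L, μ < f q)
    (hlip : ∀ a b, L ≤ a → a ≤ b → f a ≤ f b + c * (b - a)) : LipschitzBelow f c μ := by
  have hLe : ∀ d, f d ≤ μ → L ≤ d := fun d hd => by
    by_contra! h
    exact (hlt d h).not_ge hd
  refine ⟨fun d d' t ht h1 h2 => ?_, fun d d' t ht h1 h2 => ?_⟩
  · have hd : L ≤ d := hLe d (by nlinarith)
    have hd' : L ≤ d' := by
      by_contra! h
      have h3 := hlip L d le_rfl hd
      nlinarith
    exact hL ▸ hf hd'
  · rcases le_total d' d with h | h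
    · have := hf h
      nlinarith
    · have h3 := hlip d d' (hLe d h1) h
      nlinarith

theorem A1cond.lipschitzBelow_Hm {H : ℝ → ℝ} {p₀ c μ b : ℝ} (h : A1cond H p₀) (hc : 0 < c)
    (hμ : H p₀ ≤ μ) (hb : p₀ ≤ b)
    (hder : ∀ p ∈ Icc (sInf {p | Hm H p₀ p = μ}) b, |deriv H p| ≤ c) :
    LipschitzBelow (Hm H p₀) c μ := by
  obtain ⟨h1, h2, h3⟩ := h.sInf_level hμ
  refine h.antitone_Hm.lipschitzBelow hc h2 h3 fun x y hx hxy => ?_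
  have hdiff : Differentiable ℝ H := h.1.differentiable one_ne_zero
  have key := (convex_Icc (sInf {p | Hm H p₀ p = μ}) b).norm_image_sub_le_of_norm_deriv_le
    (f := H) (C := c) (x := min y p₀) (y := min x p₀) (fun z _ => hdiff z)
    (fun z hz => hder z hz)
    ⟨le_min (hx.trans hxy) h1, (min_le_right _ _).trans hb⟩
    ⟨le_min hx h1, (min_le_right _ _).trans hb⟩
  have hmin : |min x p₀ - min y p₀| ≤ y - x := by
    have := abs_min_sub_min_le_max y p₀ x p₀
    rw [sub_self, abs_zero, max_eq_left (abs_nonneg _),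
      abs_of_nonneg (sub_nonneg.2 hxy)] at this
    rwa [abs_sub_comm]
  rw [Real.norm_eq_abs, Real.norm_eq_abs] at key
  rw [Hm_eq, Hm_eq]
  have := le_abs_self (H (min x p₀) - H (min y p₀))
  nlinarith

theorem sSup_level_Hp (H : ℝ → ℝ) (p₀ μ : ℝ) :
    sSup {p | Hp H p₀ p = μ} = -sInf {p | Hm (fun p => H (-p)) (-p₀) p = μ} := by
  rw [Real.sInf_def, neg_neg]
  congr 1
  ext p
  simp [← Hp_neg]

/-- Under the CFL condition both envelopes are Lipschitz on the relevant sublevel sets. -/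
theorem A1cond.lipschitzBelow {H : ℝ → ℝ} {p₀ c μ : ℝ} (h : A1cond H p₀) (hc : 0 < c)
    (hμ : H p₀ ≤ μ)
    (hder : ∀ p ∈ Icc (sInf {p | Hm H p₀ p = μ}) (sSup {p | Hp H p₀ p = μ}), |deriv H p| ≤ c) :
    LipschitzBelow (Hm H p₀) c μ ∧ LipschitzBelow (fun q => Hp H p₀ (-q)) c μ := by
  have hμ' : (fun p => H (-p)) (-p₀) ≤ μ := by simpa using hμ
  have h1 := (h.sInf_level hμ).1
  have h2 := (h.comp_neg.sInf_level hμ').1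
  rw [sSup_level_Hp] at hder
  refine ⟨h.lipschitzBelow_Hm hc hμ (by linarith) hder, ?_⟩
  simp only [Hp_neg]
  refine h.comp_neg.lipschitzBelow_Hm hc hμ' (b := -sInf {p | Hm H p₀ p = μ}) (by linarith)
    fun p hp => ?_
  rw [deriv_comp_neg, abs_neg]
  exact hder _ ⟨by linarith [hp.2], by linarith [hp.1]⟩

section Scheme

variable {N : ℕ} {H : Fin N → ℝ → ℝ} {p₀ : Fin N → ℝ} {Δx Δt : ℝ}

theorem SchemeStep.Hm_le {U V : Fin N → ℕ → ℝ} (h : SchemeStep H p₀ Δx Δt U V) (hΔt : 0 < Δt)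
    (α : Fin N) (i : ℕ) :
    Hm (H α) (p₀ α) ((U α (i + 1) - U α i) / Δx) ≤ -((V α i - U α i) / Δt) := by
  obtain ⟨h1, -, h3⟩ := h
  rw [← neg_div, le_div_iff₀ hΔt]
  rcases i with _ | i
  · rw [h3 α]
    have := le_csSup (finite_range
      fun β : Fin N => Hm (H β) (p₀ β) ((U β 1 - U β 0) / Δx)).bddAbove (mem_range_self α)
    simp only [zero_add]
    nlinarith
  · rw [h1 α (i + 1) (by omega)]
    have := le_max_right (Hp (H α) (p₀ α) ((U α (i + 1) - U α (i + 1 - 1)) / Δx))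
      (Hm (H α) (p₀ α) ((U α (i + 1 + 1) - U α (i + 1)) / Δx))
    nlinarith

theorem SchemeStep.Hp_le {U V : Fin N → ℕ → ℝ} (h : SchemeStep H p₀ Δx Δt U V) (hΔt : 0 < Δt)
    (α : Fin N) (i : ℕ) :
    Hp (H α) (p₀ α) ((U α (i + 1) - U α i) / Δx) ≤ -((V α (i + 1) - U α (i + 1)) / Δt) := by
  rw [← neg_div, le_div_iff₀ hΔt, h.1 α (i + 1) (by omega), Nat.add_sub_cancel]
  have := le_max_left (Hp (H α) (p₀ α) ((U α (i + 1) - U α i) / Δx))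
    (Hm (H α) (p₀ α) ((U α (i + 1 + 1) - U α (i + 1)) / Δx))
  nlinarith

/-- The maximum in the scheme is attained. -/
theorem SchemeStep.attained {U V : Fin N → ℕ → ℝ} (h : SchemeStep H p₀ Δx Δt U V) (hΔt : 0 < Δt)
    (α : Fin N) (i : ℕ) :
    (∃ β, (β = α ∨ i = 0) ∧
      Hm (H β) (p₀ β) ((U β (i + 1) - U β i) / Δx) = -((V α i - U α i) / Δt)) ∨
    ∃ j, i = j + 1 ∧ Hp (H α) (p₀ α) ((U α (j + 1) - U α j) / Δx) = -((V α i - U α i) / Δt) := by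
  obtain ⟨h1, -, h3⟩ := h
  rcases i with _ | i
  · have : Nonempty (Fin N) := ⟨α⟩
    obtain ⟨β, hβ⟩ := (range_nonempty _).csSup_mem (finite_range
      fun β : Fin N => Hm (H β) (p₀ β) ((U β 1 - U β 0) / Δx))
    refine .inl ⟨β, .inr rfl, ?_⟩
    rw [h3 α, ← hβ]
    field_simp
    simp
  · rw [h1 α (i + 1) (by omega), Nat.add_sub_cancel]
    rcases max_choice (Hp (H α) (p₀ α) ((U α (i + 1) - U α i) / Δx))
      (Hm (H α) (p₀ α) ((U α (i + 1 + 1) - U α (i + 1)) / Δx)) with hm | hm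
    · refine .inr ⟨i, rfl, ?_⟩
      rw [hm]
      field_simp
      simp
    · refine .inl ⟨α, .inl rfl, ?_⟩
      rw [hm]
      field_simp
      simp

theorem SchemeStep.junction {U V : Fin N → ℕ → ℝ} (h : SchemeStep H p₀ Δx Δt U V)
    {α β : Fin N} {i : ℕ} (hβ : β = α ∨ i = 0) : V β i - U β i = V α i - U α i := by
  rcases hβ with rfl | rfl
  · rfl
  · rw [h.2.2 α, h.2.2 β, h.2.1 α β]

/-- Bounds on the discrete time derivative propagate from one time step to the next. -/
theorem SchemeStep.bounds_succ {U V W : Fin N → ℕ → ℝ} (h : SchemeStep H p₀ Δx Δt U V)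
    (h' : SchemeStep H p₀ Δx Δt V W) (hΔx : 0 < Δx) (hΔt : 0 < Δt) {m M : ℝ}
    (hm : ∀ α, LipschitzBelow (Hm (H α) (p₀ α)) (Δx / Δt) (-m))
    (hp : ∀ α, LipschitzBelow (fun q => Hp (H α) (p₀ α) (-q)) (Δx / Δt) (-m))
    (hb : ∀ α i, m ≤ (V α i - U α i) / Δt ∧ (V α i - U α i) / Δt ≤ M) (α : Fin N) (i : ℕ) :
    m ≤ (W α i - V α i) / Δt ∧ (W α i - V α i) / Δt ≤ M := by
  have hc : ∀ a b : ℝ, Δx / Δt * ((a - b) * Δt / Δx) = a - b := fun a b => by field_simp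
  have hcd : ∀ β j, (V β (j + 1) - V β j) / Δx = (U β (j + 1) - U β j) / Δx +
      ((V β (j + 1) - U β (j + 1)) / Δt - (V β j - U β j) / Δt) * Δt / Δx := fun β j => by
    field_simp
    ring
  have hmono : ∀ a b : ℝ, a ≤ b → a * Δt / Δx ≤ b * Δt / Δx := fun a b hab => by gcongr
  have hnn : ∀ a b : ℝ, b ≤ a → 0 ≤ (a - b) * Δt / Δx := fun a b hab =>
    div_nonneg (mul_nonneg (sub_nonneg.2 hab) hΔt.le) hΔx.le
  have hlin : ∀ a b : ℝ, (a - b) * Δt / Δx = -((b - a) * Δt / Δx) := fun a b => by ring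
  have lowm : ∀ β j, Hm (H β) (p₀ β) ((V β (j + 1) - V β j) / Δx) ≤ -m := fun β j => by
    refine (hm β).1 ((U β (j + 1) - U β j) / Δx) _ (((V β j - U β j) / Δt - m) * Δt / Δx)
      (hnn _ _ (hb β j).1) ?_ ?_
    · rw [hc]
      linarith [h.Hm_le hΔt β j]
    · rw [hcd, sub_eq_add_neg, ← hlin]
      linarith [hmono _ _ (sub_le_sub_right (hb β (j + 1)).1 ((V β j - U β j) / Δt))]
  have lowp : ∀ β j, Hp (H β) (p₀ β) ((V β (j + 1) - V β j) / Δx) ≤ -m := fun β j => by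
    have := (hp β).1 (-((U β (j + 1) - U β j) / Δx)) (-((V β (j + 1) - V β j) / Δx))
      (((V β (j + 1) - U β (j + 1)) / Δt - m) * Δt / Δx) (hnn _ _ (hb β (j + 1)).1) ?_ ?_
    · simpa only [neg_neg] using this
    · rw [hc]
      simp only [neg_neg]
      linarith [h.Hp_le hΔt β j]
    · rw [hcd]
      linarith [hmono _ _ (sub_le_sub_left (hb β j).1 ((V β (j + 1) - U β (j + 1)) / Δt))]
  constructor
  · rcases h'.attained hΔt α i with ⟨β, -, he⟩ | ⟨j, -, he⟩
    · linarith [lowm β i]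
    · linarith [lowp α j]
  · rcases h.attained hΔt α i with ⟨β, hβ, he⟩ | ⟨j, rfl, he⟩
    · have h1 := (hm β).2 ((U β (i + 1) - U β i) / Δx) ((V β (i + 1) - V β i) / Δx)
        ((M - (V β i - U β i) / Δt) * Δt / Δx) (hnn _ _ (hb β i).2)
        (by linarith [(hb α i).1]) ?_
      · rw [hc] at h1
        have h2 := h'.Hm_le hΔt β i
        rw [h'.junction hβ] at h2
        rw [h.junction hβ] at h1
        linarith
      · rw [hcd]
        linarith [hmono _ _ (sub_le_sub_right (hb β (i + 1)).2 ((V β i - U β i) / Δt))]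
    · have h1 := (hp α).2 (-((U α (j + 1) - U α j) / Δx)) (-((V α (j + 1) - V α j) / Δx))
        ((M - (V α (j + 1) - U α (j + 1)) / Δt) * Δt / Δx) (hnn _ _ (hb α (j + 1)).2) ?_ ?_
      · simp only [neg_neg] at h1
        rw [hc] at h1
        linarith [h'.Hp_le hΔt α j]
      · simp only [neg_neg]
        linarith [(hb α (j + 1)).1]
      · rw [hcd, hlin M]
        linarith [hmono _ _ (sub_le_sub_left (hb α j).2 ((V α (j + 1) - U α (j + 1)) / Δt))]

end Scheme

/-- **Linear-in-time bounds on the numerical solution** (Step 1 of the proof of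
Theorem 3.7). Assume (A0) and (A1), and suppose the CFL condition (CFL′) holds.
If `U` is the numerical solution of (NS) with `U^{α,0}_i = u₀^α(iΔx)`, then for all
`α`, `i`, `n`: `m⁰₀·nΔt ≤ U^{α,n}_i − U^{α,0}_i ≤ M⁰₀·nΔt`. -/
theorem linear_in_time_bounds {N : ℕ} (hN : 1 ≤ N)
    (H : Fin N → ℝ → ℝ) (p₀ : Fin N → ℝ)
    (hA1 : ∀ α, A1cond (H α) (p₀ α))
    (u₀ : Fin N → ℝ → ℝ)
    (hcompat : ∀ α β : Fin N, u₀ α 0 = u₀ β 0)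
    (Lm Lp : Fin N → ℝ)
    (hLp : ∀ α, IsLeast
      {L : ℝ | ∀ x a : ℝ, 0 ≤ x → 0 ≤ a → u₀ α (x + a) - u₀ α x ≤ a * L} (Lp α))
    (hLm : ∀ α, IsGreatest
      {L : ℝ | ∀ x a : ℝ, 0 ≤ x → 0 ≤ a → a * L ≤ u₀ α (x + a) - u₀ α x} (Lm α))
    (Δx Δt : ℝ) (hΔx : 0 < Δx) (hΔt : 0 < Δt)
    (U : Fin N → ℕ → ℕ → ℝ)
    (hU : SchemeNS H p₀ Δx Δt U)
    (hinit : ∀ (α : Fin N) (i : ℕ), U α 0 i = u₀ α (i * Δx))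
    (m0 : ℝ)
    (hm0 : m0 = sInf (Set.range fun q : Fin N × ℕ => (U q.1 1 q.2 - U q.1 0 q.2) / Δt))
    (plow pbar : Fin N → ℝ)
    (hplow : ∀ α, plow α = sInf {p : ℝ | Hm (H α) (p₀ α) p = -m0})
    (hpbar : ∀ α, pbar α = sSup {p : ℝ | Hp (H α) (p₀ α) p = -m0})
    (hCFL : ∀ α : Fin N, ∀ p ∈ Icc (plow α) (pbar α), |deriv (H α) p| ≤ Δx / Δt)
    (m00 M00 : ℝ)
    (hm00 : m00 = sInf {v : ℝ | ∃ (α : Fin N) (p : ℝ),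
      Lm α ≤ p ∧ p ≤ Lp α ∧ v = -(H α p)})
    (hM00 : M00 = max
      (sSup (Set.range fun α : Fin N =>
        min (-(Hp (H α) (p₀ α) (Lm α))) (-(Hm (H α) (p₀ α) (Lp α)))))
      (sInf (Set.range fun α : Fin N => -(Hm (H α) (p₀ α) (Lp α))))) :
    ∀ (α : Fin N) (n i : ℕ),
      m00 * (n * Δt) ≤ U α n i - U α 0 i ∧ U α n i - U α 0 i ≤ M00 * (n * Δt) := by
  have hstep : ∀ n, SchemeStep H p₀ Δx Δt (fun α i => U α n i) (fun α i => U α (n + 1) i) := hU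
  have hgrad : ∀ α i, Lm α ≤ (U α 0 (i + 1) - U α 0 i) / Δx ∧
      (U α 0 (i + 1) - U α 0 i) / Δx ≤ Lp α := fun α i => by
    have hx : (0 : ℝ) ≤ i * Δx := by positivity
    have h1 := (hLm α).1 (i * Δx) Δx hx hΔx.le
    have h2 := (hLp α).1 (i * Δx) Δx hx hΔx.le
    rw [le_div_iff₀ hΔx, div_le_iff₀ hΔx, hinit, hinit]
    push_cast
    rw [add_mul, one_mul]
    constructor <;> linarith
  have hbdd : BddBelow {v : ℝ | ∃ (α : Fin N) (p : ℝ), Lm α ≤ p ∧ p ≤ Lp α ∧ v = -(H α p)} := by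
    have hK : ∀ α, ∃ B, ∀ p ∈ Icc (Lm α) (Lp α), H α p ≤ B := fun α => by
      obtain ⟨B, hB⟩ := (isCompact_Icc (a := Lm α) (b := Lp α)).bddAbove_image
        (hA1 α).1.continuous.continuousOn
      exact ⟨B, fun p hp => hB (mem_image_of_mem _ hp)⟩
    choose B hB using hK
    obtain ⟨C, hC⟩ := (finite_range B).bddAbove
    refine ⟨-C, ?_⟩
    rintro v ⟨α, p, h1, h2, rfl⟩
    exact neg_le_neg ((hB α p ⟨h1, h2⟩).trans (hC (mem_range_self α)))
  have hm00le : ∀ α i, m00 ≤ -(H α ((U α 0 (i + 1) - U α 0 i) / Δx)) := fun α i =>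
    hm00 ▸ csInf_le hbdd ⟨α, _, (hgrad α i).1, (hgrad α i).2, rfl⟩
  have hlow : ∀ α i, m00 ≤ (U α 1 i - U α 0 i) / Δt := fun α i => by
    rcases (hstep 0).attained hΔt α i with ⟨β, -, he⟩ | ⟨j, -, he⟩
    · have h1 := (hA1 β).Hm_le ((U β 0 (i + 1) - U β 0 i) / Δx)
      have h2 := hm00le β i
      simp only [zero_add] at he
      linarith
    · have h1 := (hA1 α).Hp_le ((U α 0 (j + 1) - U α 0 j) / Δx)
      have h2 := hm00le α j
      simp only [zero_add] at he
      linarith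
  have hm0le : ∀ α i, m0 ≤ (U α 1 i - U α 0 i) / Δt := fun α i => by
    rw [hm0]
    refine csInf_le ⟨m00, ?_⟩ (mem_range_self (α, i))
    rintro _ ⟨q, rfl⟩
    exact hlow _ _
  have hup : ∀ α i, (U α 1 i - U α 0 i) / Δt ≤ M00 := fun α i => by
    rcases i with _ | j
    · have : Nonempty (Fin N) := ⟨α⟩
      rw [hM00]
      refine le_trans (le_csInf (range_nonempty _) ?_) (le_max_right _ _)
      rintro _ ⟨β, rfl⟩
      have h2 := (hstep 0).Hm_le hΔt β 0
      rw [(hstep 0).junction (α := α) (.inr rfl)] at h2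
      have h4 := (hA1 β).antitone_Hm (hgrad β 0).2
      simp only [zero_add] at h2 h4
      linarith
    · rw [hM00]
      refine le_trans ?_ ((le_csSup (finite_range _).bddAbove (mem_range_self α)).trans
        (le_max_left _ _))
      have h1 := (hstep 0).Hp_le hΔt α j
      have h2 := (hstep 0).Hm_le hΔt α (j + 1)
      have h3 := (hA1 α).monotone_Hp (hgrad α j).1
      have h4 := (hA1 α).antitone_Hm (hgrad α (j + 1)).2
      simp only [zero_add] at h1 h2
      exact le_min (by linarith) (by linarith)
  have hμ : ∀ α, H α (p₀ α) ≤ -m0 := fun α => by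
    have h1 := (hstep 0).Hm_le hΔt α 0
    have h2 := (hA1 α).le_Hm ((U α 0 (0 + 1) - U α 0 0) / Δx)
    have h3 := hm0le α 0
    simp only [zero_add] at h1 h2
    linarith
  have hlip := fun α => (hA1 α).lipschitzBelow (div_pos hΔx hΔt) (hμ α)
    (by rw [← hplow, ← hpbar]; exact hCFL α)
  have hW : ∀ n α i, m0 ≤ (U α (n + 1) i - U α n i) / Δt ∧
      (U α (n + 1) i - U α n i) / Δt ≤ M00 := fun n => by
    induction n with
    | zero => exact fun α i => ⟨hm0le α i, hup α i⟩
    | succ n ih =>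
      exact (hstep n).bounds_succ (hstep (n + 1)) hΔx hΔt (fun α => (hlip α).1)
        (fun α => (hlip α).2) ih
  intro α n i
  have : Nonempty (Fin N × ℕ) := ⟨(α, 0)⟩
  have hm00m0 : m00 ≤ m0 := by
    rw [hm0]
    refine le_csInf (range_nonempty _) ?_
    rintro _ ⟨q, rfl⟩
    exact hlow _ _
  induction n with
  | zero => simp
  | succ n ih =>
    have h1 := hW n α i
    rw [le_div_iff₀ hΔt, div_le_iff₀ hΔt] at h1
    have h2 := mul_le_mul_of_nonneg_right hm00m0 hΔt.le
    push_cast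
    constructor <;> nlinarith [ih.1, ih.2, h1.1, h1.2]
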